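/- arXiv:1212.6100 — 2 statements merged into one kernel-verified Lean document; each statement's English description precedes it below -/
import Mathlib

section
/- There exists a constant C₆ > 0 such that for every s > 0 and every f ∈ C_b^∞(ℝ^d) with μ_V(f) = 0, the weak Poincaré inequality μ_V(f²) ≤ C₆ α₂(s) · 𝓓_{α,V}(f,f) + s ‖f‖_∞² holds, where α₂(s) := inf{ r^{2d+α} K(r)/k(r) : r > 3 and μ_V(ℝ^d ∖ B(0,r)) ≤ s/(1+s) }. -/
open MeasureTheory Real Set Metric Filter

noncomputable section

/-- Euclidean space `ℝ^d`. -/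
abbrev Ed (d : ℕ) := EuclideanSpace ℝ (Fin d)

/-- The probability measure `μ_V(dx) = C_V e^{-V(x)} dx` with `C_V = (∫ e^{-V})⁻¹`. -/
def muV (d : ℕ) (V : Ed d → ℝ) : Measure (Ed d) :=
  (volume : Measure (Ed d)).withDensity
    fun x => ENNReal.ofReal ((∫ y, Real.exp (-V y))⁻¹ * Real.exp (-V x))

/-- `f ∈ C_b^∞(ℝ^d)`: smooth with bounded derivatives of every order. -/
def CbSmooth (d : ℕ) (f : Ed d → ℝ) : Prop :=
  ContDiff ℝ (⊤ : ℕ∞) f ∧ ∀ n : ℕ, ∃ C : ℝ, ∀ x, ‖iteratedFDeriv ℝ n f x‖ ≤ C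

/-- `V` is locally bounded. -/
def LocallyBounded (d : ℕ) (V : Ed d → ℝ) : Prop :=
  ∀ r : ℝ, ∃ M : ℝ, ∀ x : Ed d, ‖x‖ ≤ r → |V x| ≤ M

/-- The nonlocal Dirichlet form with finite range jumps `𝓔_{α,V}`. -/
def formE (d : ℕ) (α : ℝ) (V f : Ed d → ℝ) : ℝ :=
  (1/2) * ∫ x, (∫ y in {y : Ed d | dist x y ≤ 1},
      (f x - f y) ^ 2 / dist x y ^ ((d : ℝ) + α)) ∂(muV d V)

/-- The nonlocal Dirichlet form with large jumps `𝓓_{α,V}`. -/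
def formD (d : ℕ) (α : ℝ) (V f : Ed d → ℝ) : ℝ :=
  (1/2) * ∫ x, (∫ y in {y : Ed d | 1 < dist x y},
      (f x - f y) ^ 2 / dist x y ^ ((d : ℝ) + α)) ∂(muV d V)

/-- `inf_{z : |x|-1 ≤ |z| ≤ |x|-1/2} e^{-V(z)}`. -/
def infAnn (d : ℕ) (V : Ed d → ℝ) (x : Ed d) : ℝ :=
  sInf ((fun z => Real.exp (-V z)) '' {z : Ed d | ‖x‖ - 1 ≤ ‖z‖ ∧ ‖z‖ ≤ ‖x‖ - 1/2})

/-- `sup_{z : |x| ≤ |z| ≤ |x|+1} e^{-V(z)}`. -/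
def supAnn (d : ℕ) (V : Ed d → ℝ) (x : Ed d) : ℝ :=
  sSup ((fun z => Real.exp (-V z)) '' {z : Ed d | ‖x‖ ≤ ‖z‖ ∧ ‖z‖ ≤ ‖x‖ + 1})

/-- `K(r) = sup_{|x| ≤ r} e^{-V(x)}`. -/
def Kfun (d : ℕ) (V : Ed d → ℝ) (r : ℝ) : ℝ :=
  sSup ((fun x => Real.exp (-V x)) '' {x : Ed d | ‖x‖ ≤ r})

/-- `k(r) = inf_{|x| ≤ r+1} e^{-V(x)}`. -/
def kfun (d : ℕ) (V : Ed d → ℝ) (r : ℝ) : ℝ :=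
  sInf ((fun x => Real.exp (-V x)) '' {x : Ed d | ‖x‖ ≤ r + 1})

/-- The constant `(1/α)·2^{2d+1}·(e + e^{1/2})·(2^α − 1)`. -/
def thresholdConst (d : ℕ) (α : ℝ) : ℝ :=
  (1/α) * (2:ℝ) ^ (2*d+1) * (Real.exp 1 + Real.exp (1/2)) * ((2:ℝ) ^ α - 1)

/-- `α₂(s) = inf { r^{2d+α} K(r)/k(r) : r > 3, μ_V(B(0,r)ᶜ) ≤ s/(1+s) }`. -/
def alpha2 (d : ℕ) (α : ℝ) (V : Ed d → ℝ) (s : ℝ) : ℝ :=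
  sInf ((fun r : ℝ => r ^ (2*(d:ℝ) + α) * Kfun d V r / kfun d V r) ''
    {r : ℝ | 3 < r ∧ muV d V ((ball (0 : Ed d) r)ᶜ) ≤ ENNReal.ofReal (s/(1+s))})

theorem muV_isProbabilityMeasure (d : ℕ) (V : Ed d → ℝ)
    (hVint : Integrable (fun x => Real.exp (-V x))) : IsProbabilityMeasure (muV d V) := by
  have hpos : 0 < ∫ y, Real.exp (-V y) := integral_exp_pos hVint
  constructor
  rw [muV, withDensity_apply _ MeasurableSet.univ, Measure.restrict_univ,
    ← ofReal_integral_eq_lintegral_ofReal (hVint.const_mul _)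
      (Eventually.of_forall fun x => by positivity), integral_const_mul,
    inv_mul_cancel₀ hpos.ne', ENNReal.ofReal_one]

theorem kfun_pos_and_le_Kfun (d : ℕ) (V : Ed d → ℝ) (hVloc : LocallyBounded d V)
    {r : ℝ} (hr : 0 ≤ r) : 0 < kfun d V r ∧ kfun d V r ≤ Kfun d V r := by
  obtain ⟨M, hM⟩ := hVloc (r + 1)
  have h0 : (0 : Ed d) ∈ {x : Ed d | ‖x‖ ≤ r} := by simpa using hr
  have h1 : (0 : Ed d) ∈ {x : Ed d | ‖x‖ ≤ r + 1} := by simp; linarith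
  constructor
  · refine (Real.exp_pos (-M)).trans_le (le_csInf (Set.Nonempty.image _ ⟨0, h1⟩) ?_)
    rintro _ ⟨x, hx, rfl⟩
    exact Real.exp_le_exp.2 (neg_le_neg ((le_abs_self _).trans (hM x hx)))
  · refine (csInf_le (a := Real.exp (-V 0)) ⟨0, ?_⟩
        (mem_image_of_mem (fun x => Real.exp (-V x)) h1)).trans
      (le_csSup ⟨Real.exp M, ?_⟩ (mem_image_of_mem (fun x => Real.exp (-V x)) h0))
    · rintro _ ⟨x, -, rfl⟩
      exact (Real.exp_pos _).le
    · rintro _ ⟨x, hx, rfl⟩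
      refine Real.exp_le_exp.2 ((neg_le_abs _).trans (hM x ?_))
      have : ‖x‖ ≤ r := hx
      linarith

/-- A local bound of `(f x - f y)²` by `a (G x + G y)` on a set `B` of large measure gives a weak
Poincaré inequality. -/
theorem integral_sq_le_of_forall_mem_sq_sub_le {Ω : Type*} [MeasurableSpace Ω] {μ : Measure Ω}
    [IsProbabilityMeasure μ] {f G : Ω → ℝ} {B : Set Ω} {a s S : ℝ} (hB : MeasurableSet B)
    (hf : Measurable f) (hfS : ∀ x, |f x| ≤ S) (hf0 : ∫ x, f x ∂μ = 0)
    (hG : Integrable G μ) (hG0 : ∀ x, 0 ≤ G x) (ha : 0 ≤ a) (hm : 0 < μ.real B)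
    (hs : μ.real Bᶜ ≤ s * μ.real B)
    (h : ∀ x ∈ B, ∀ y ∈ B, (f x - f y) ^ 2 ≤ a * (G x + G y)) :
    ∫ x, f x ^ 2 ∂μ ≤ a * ∫ x, G x ∂μ + s * S ^ 2 := by
  have hfi : Integrable f μ :=
    Integrable.of_bound hf.aestronglyMeasurable S (Eventually.of_forall hfS)
  have hsq : ∀ x, f x ^ 2 ≤ S ^ 2 := fun x => sq_le_sq' (by linarith [neg_abs_le (f x), hfS x])
    ((le_abs_self _).trans (hfS x))
  have hf2 : Integrable (fun x => f x ^ 2) μ :=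
    Integrable.of_bound (hf.pow_const 2).aestronglyMeasurable (S ^ 2)
      (Eventually.of_forall fun x => by
        rw [Real.norm_of_nonneg (sq_nonneg _)]; exact hsq x)
  set m := μ.real B with hmdef
  set F2 := ∫ x in B, f x ^ 2 ∂μ with hF2
  set F := ∫ x in B, f x ∂μ with hF
  set I := ∫ x in B, G x ∂μ with hI
  have h1 : ∀ y ∈ B, F2 - 2 * f y * F + m * f y ^ 2 ≤ a * (I + m * G y) := by
    intro y hy
    have e1 : ∫ x in B, (f x - f y) ^ 2 ∂μ = F2 - 2 * f y * F + m * f y ^ 2 := by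
      have : ∀ x, (f x - f y) ^ 2 = f x ^ 2 - 2 * f y * f x + f y ^ 2 := fun x => by ring
      simp_rw [this]
      have j : IntegrableOn (fun x => f x ^ 2 - 2 * f y * f x) B μ :=
        hf2.integrableOn.sub (hfi.integrableOn.const_mul _)
      rw [integral_add j (integrable_const _),
        integral_sub hf2.integrableOn (hfi.integrableOn.const_mul _), integral_const_mul]
      simp [hmdef, hF2, hF]
    have e2 : ∫ x in B, a * (G x + G y) ∂μ = a * (I + m * G y) := by
      rw [integral_const_mul, integral_add hG.integrableOn (integrable_const _)]
      simp [hmdef, hI]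
    rw [← e1, ← e2]
    refine setIntegral_mono_on ?_ ((hG.integrableOn.add (integrable_const _)).const_mul _) hB
      fun x hx => h x hx y hy
    have : ∀ x, (f x - f y) ^ 2 = f x ^ 2 - 2 * f y * f x + f y ^ 2 := fun x => by ring
    simp_rw [this]
    exact (hf2.integrableOn.sub (hfi.integrableOn.const_mul _)).add (integrable_const _)
  have h2 : m * F2 - 2 * F * F + m * F2 ≤ a * (m * I + m * I) := by
    have j1 : IntegrableOn (fun y => F2 - 2 * F * f y) B μ :=
      (integrable_const _).sub (hfi.integrableOn.const_mul _)
    have j2 : IntegrableOn (fun y => m * f y ^ 2) B μ := hf2.integrableOn.const_mul _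
    have j3 : IntegrableOn (fun y => m * G y) B μ := hG.integrableOn.const_mul _
    have key : ∫ y in B, (F2 - 2 * F * f y + m * f y ^ 2) ∂μ
        ≤ ∫ y in B, a * (I + m * G y) ∂μ :=
      setIntegral_mono_on (j1.add j2) (((integrable_const _).add j3).const_mul _) hB
        fun y hy => by linarith [h1 y hy]
    rw [integral_add j1 j2, integral_sub (integrable_const _) (hfi.integrableOn.const_mul _),
      integral_const_mul, integral_const_mul, integral_const_mul,
      integral_add (integrable_const _) j3, integral_const_mul] at key
    simpa [hmdef] using key
  have hsplit : F + ∫ x in Bᶜ, f x ∂μ = 0 := by rw [hF, integral_add_compl hB hfi, hf0]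
  have hFabs : |F| ≤ S * μ.real Bᶜ := by
    have : F = -∫ x in Bᶜ, f x ∂μ := by linarith
    rw [this, abs_neg]
    exact norm_setIntegral_le_of_norm_le_const (f := f) (measure_lt_top _ _) fun x _ => hfS x
  have hF2abs : F ^ 2 ≤ (S * μ.real Bᶜ) ^ 2 :=
    sq_le_sq' (by linarith [neg_abs_le F]) ((le_abs_self _).trans hFabs)
  have hc : ∫ x in Bᶜ, f x ^ 2 ∂μ ≤ S ^ 2 * μ.real Bᶜ := by
    calc ∫ x in Bᶜ, f x ^ 2 ∂μ ≤ ∫ x in Bᶜ, S ^ 2 ∂μ :=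
          setIntegral_mono hf2.integrableOn (integrable_const _) hsq
      _ = S ^ 2 * μ.real Bᶜ := by simp [mul_comm]
  have hcm : μ.real Bᶜ = 1 - m := probReal_compl_eq_one_sub hB
  have hIG : I ≤ ∫ x, G x ∂μ := setIntegral_le_integral hG (Eventually.of_forall hG0)
  rw [← integral_add_compl hB hf2]
  have hmain : m * (F2 + ∫ x in Bᶜ, f x ^ 2 ∂μ) ≤ m * (a * ∫ x, G x ∂μ + s * S ^ 2) := by
    rw [hcm] at hF2abs hc hs
    have q1 : a * (m * I) ≤ a * (m * ∫ x, G x ∂μ) := by gcongr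
    have q2 : m * ∫ x in Bᶜ, f x ^ 2 ∂μ ≤ m * (S ^ 2 * (1 - m)) := by gcongr
    have q3 : S ^ 2 * (1 - m) ≤ S ^ 2 * (s * m) := by gcongr
    nlinarith
  exact le_of_mul_le_mul_left hmain hm

theorem exists_lt_measure_compl_ball_le {E : Type*} [PseudoMetricSpace E] [MeasurableSpace E]
    [OpensMeasurableSpace E] (μ : Measure E) [IsFiniteMeasure μ] (x : E) (R : ℝ)
    {ε : ENNReal} (hε : 0 < ε) : ∃ r, R < r ∧ μ (ball x r)ᶜ ≤ ε := by
  have h := tendsto_measure_iInter_atTop (μ := μ) (s := fun r : ℝ => (ball x r)ᶜ)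
    (fun r => measurableSet_ball.compl.nullMeasurableSet)
    (fun a b hab => compl_subset_compl.2 (ball_subset_ball hab)) ⟨0, measure_ne_top _ _⟩
  have h0 : (⋂ r : ℝ, (ball x r)ᶜ) = ∅ := by
    rw [← compl_iUnion, compl_empty_iff, eq_univ_iff_forall]
    exact fun y => mem_iUnion.2 ⟨dist y x + 1, by simp⟩
  rw [h0, measure_empty] at h
  obtain ⟨r, h1, h2⟩ := ((h.eventually_le_const hε).and (eventually_gt_atTop R)).exists
  exact ⟨r, h2, h1⟩

/-- The density in `y` of the large jump form at `x`. -/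
def jumpDensity (d : ℕ) (α : ℝ) (f : Ed d → ℝ) (x y : Ed d) : ℝ :=
  (f x - f y) ^ 2 / dist x y ^ ((d : ℝ) + α)

theorem jumpDensity_nonneg (d : ℕ) (α : ℝ) (f : Ed d → ℝ) (x y : Ed d) :
    0 ≤ jumpDensity d α f x y := by
  unfold jumpDensity; positivity

theorem measurable_jumpDensity (d : ℕ) (α : ℝ) {f : Ed d → ℝ} (hf : Measurable f) :
    Measurable fun p : Ed d × Ed d => jumpDensity d α f p.1 p.2 := by
  unfold jumpDensity; fun_prop

theorem measurableSet_one_lt_dist (d : ℕ) (x : Ed d) :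
    MeasurableSet {y : Ed d | 1 < dist x y} :=
  measurableSet_lt measurable_const (by fun_prop)

theorem jumpDensity_le (d : ℕ) {α S : ℝ} (hα : 0 < α) {f : Ed d → ℝ} (hfS : ∀ x, |f x| ≤ S)
    {x y : Ed d} (hxy : 1 < dist x y) :
    jumpDensity d α f x y ≤
      4 * S ^ 2 * (2 ^ ((d : ℝ) + α) * (1 + ‖x - y‖) ^ (-((d : ℝ) + α))) := by
  have hp : 0 ≤ (d : ℝ) + α := by positivity
  rw [jumpDensity, div_eq_mul_inv]
  rw [dist_eq_norm] at hxy ⊢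
  have h1 : (f x - f y) ^ 2 ≤ 4 * S ^ 2 := by
    have h := abs_le.1 (hfS x)
    have h' := abs_le.1 (hfS y)
    nlinarith
  have h2 : (‖x - y‖ ^ ((d : ℝ) + α))⁻¹ ≤
      2 ^ ((d : ℝ) + α) * (1 + ‖x - y‖) ^ (-((d : ℝ) + α)) := by
    rw [Real.rpow_neg (by positivity), ← div_eq_mul_inv, ← Real.div_rpow (by norm_num)
      (by positivity), ← Real.inv_rpow (by positivity)]
    refine Real.rpow_le_rpow (by positivity) ?_ hp
    rw [inv_le_comm₀ (by linarith) (by positivity), inv_div]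
    linarith
  exact mul_le_mul h1 h2 (by positivity) (by positivity)

theorem integrable_one_add_norm_sub (d : ℕ) {α : ℝ} (hα : 0 < α) (x : Ed d) :
    Integrable fun y : Ed d => (1 + ‖x - y‖) ^ (-((d : ℝ) + α)) :=
  (integrable_one_add_norm (E := Ed d) (μ := volume) (r := (d : ℝ) + α)
    (by simpa using hα)).comp_sub_left x

theorem integrableOn_jumpDensity (d : ℕ) {α S : ℝ} (hα : 0 < α) {f : Ed d → ℝ}
    (hf : Measurable f) (hfS : ∀ x, |f x| ≤ S) (x : Ed d) :
    IntegrableOn (jumpDensity d α f x) {y | 1 < dist x y} := by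
  refine Integrable.mono' (((integrable_one_add_norm_sub d hα x).const_mul
      (2 ^ ((d : ℝ) + α))).const_mul (4 * S ^ 2)).integrableOn
    ((measurable_jumpDensity d α hf).comp measurable_prodMk_left).aestronglyMeasurable ?_
  filter_upwards [ae_restrict_mem (measurableSet_one_lt_dist d x)] with y hy
  rw [Real.norm_of_nonneg (jumpDensity_nonneg ..)]
  exact jumpDensity_le d hα hfS hy

theorem integrable_setIntegral_jumpDensity (d : ℕ) {α S : ℝ} (hα : 0 < α) {f : Ed d → ℝ}
    (hf : Measurable f) (hfS : ∀ x, |f x| ≤ S) (μ : Measure (Ed d)) [IsFiniteMeasure μ] :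
    Integrable (fun x => ∫ y in {y | 1 < dist x y}, jumpDensity d α f x y) μ := by
  have hmeas : StronglyMeasurable fun x : Ed d =>
      ∫ y in {y | 1 < dist x y}, jumpDensity d α f x y := by
    simp_rw [← integral_indicator (measurableSet_one_lt_dist d _)]
    have : Measurable fun p : Ed d × Ed d =>
        ({q : Ed d × Ed d | 1 < dist q.1 q.2}.indicator
          fun q => jumpDensity d α f q.1 q.2) p :=
      (measurable_jumpDensity d α hf).indicator
        (measurableSet_lt measurable_const (by fun_prop))
    exact this.stronglyMeasurable.integral_prod_right
  refine Integrable.of_bound hmeas.aestronglyMeasurable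
    (∫ y : Ed d, 4 * S ^ 2 * (2 ^ ((d : ℝ) + α) * (1 + ‖y‖) ^ (-((d : ℝ) + α))))
    (Eventually.of_forall fun x => ?_)
  have hint := ((integrable_one_add_norm_sub d hα x).const_mul
      (2 ^ ((d : ℝ) + α))).const_mul (4 * S ^ 2)
  rw [Real.norm_of_nonneg (integral_nonneg fun y => jumpDensity_nonneg ..),
    ← integral_sub_left_eq_self (fun y : Ed d => 4 * S ^ 2 *
      (2 ^ ((d : ℝ) + α) * (1 + ‖y‖) ^ (-((d : ℝ) + α)))) volume x]
  refine (setIntegral_mono_on (integrableOn_jumpDensity d hα hf hfS x) hint.integrableOn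
    (measurableSet_one_lt_dist d x) fun y hy => jumpDensity_le d hα hfS hy).trans ?_
  exact setIntegral_le_integral hint (Eventually.of_forall fun y => by positivity)

theorem volume_ball_one_le_ball_three_diff (d : ℕ) (hd : 1 ≤ d) (x y : Ed d) :
    volume.real (ball (0 : Ed d) 1) ≤
      volume.real (ball (0 : Ed d) 3 \ (closedBall x 1 ∪ closedBall y 1)) := by
  have : Nonempty (Fin d) := ⟨⟨0, hd⟩⟩
  have h3 : volume.real (ball (0 : Ed d) 3) = 3 ^ d * volume.real (ball (0 : Ed d) 1) := by
    rw [measureReal_def, Measure.addHaar_ball _ _ (by norm_num), ENNReal.toReal_mul,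
      ENNReal.toReal_ofReal (by positivity)]
    simp [measureReal_def]
  have h1 : ∀ z : Ed d, volume.real (closedBall z 1) = volume.real (ball (0 : Ed d) 1) := by
    intro z
    rw [measureReal_def, Measure.addHaar_closedBall _ _ (by norm_num)]
    simp [measureReal_def]
  have hu := measureReal_union_le (μ := volume) (closedBall x 1) (closedBall y 1)
  rw [h1, h1] at hu
  have hdiff := le_measureReal_sdiff (μ := volume) (s₁ := ball (0 : Ed d) 3)
    (s₂ := closedBall x 1 ∪ closedBall y 1)
    ((measure_union_lt_top measure_closedBall_lt_top measure_closedBall_lt_top).ne)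
  have h3d : (3 : ℝ) ≤ 3 ^ d := by
    simpa using pow_le_pow_right₀ (by norm_num : (1 : ℝ) ≤ 3) hd
  have := mul_le_mul_of_nonneg_right h3d
    (measureReal_nonneg (μ := volume) (s := ball (0 : Ed d) 1))
  linarith

/-- Two points of a ball are compared through an average over intermediate points at distance
more than one from both of them. -/
theorem sq_sub_le_setIntegral_jumpDensity (d : ℕ) (hd : 1 ≤ d) {α S r : ℝ} (hα : 0 < α)
    (hr : 3 < r) {f : Ed d → ℝ} (hf : Measurable f) (hfS : ∀ x, |f x| ≤ S) {x y : Ed d}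
    (hx : x ∈ ball (0 : Ed d) r) (hy : y ∈ ball (0 : Ed d) r) :
    volume.real (ball (0 : Ed d) 1) * (f x - f y) ^ 2 ≤ 2 * (2 * r) ^ ((d : ℝ) + α) *
      ((∫ z in {z | 1 < dist x z}, jumpDensity d α f x z) +
        ∫ z in {z | 1 < dist y z}, jumpDensity d α f y z) := by
  set A : Set (Ed d) := ball (0 : Ed d) 3 \ (closedBall x 1 ∪ closedBall y 1) with hA
  have hAm : MeasurableSet A :=
    measurableSet_ball.diff (measurableSet_closedBall.union measurableSet_closedBall)
  have hAfin : volume A ≠ ⊤ := ((measure_mono sdiff_subset).trans_lt measure_ball_lt_top).ne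
  have hAx : A ⊆ {z | 1 < dist x z} := fun z hz => by
    by_contra h
    exact hz.2 (Or.inl (by rw [mem_closedBall, dist_comm]; exact not_lt.1 h))
  have hAy : A ⊆ {z | 1 < dist y z} := fun z hz => by
    by_contra h
    exact hz.2 (Or.inr (by rw [mem_closedBall, dist_comm]; exact not_lt.1 h))
  have hix := integrableOn_jumpDensity d hα hf hfS x
  have hiy := integrableOn_jumpDensity d hα hf hfS y
  have hbound : ∀ w ∈ ball (0 : Ed d) r, ∀ z ∈ ball (0 : Ed d) 3, 1 < dist w z →
      (f w - f z) ^ 2 ≤ (2 * r) ^ ((d : ℝ) + α) * jumpDensity d α f w z := by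
    intro w hw z hz hwz
    have hdist : dist w z ≤ 2 * r := by
      have := dist_triangle_right w z 0
      rw [mem_ball] at hw hz
      linarith
    have hpos : 0 < dist w z ^ ((d : ℝ) + α) := Real.rpow_pos_of_pos (by linarith) _
    rw [jumpDensity, mul_div_assoc', le_div_iff₀ hpos, mul_comm]
    gcongr
  calc volume.real (ball (0 : Ed d) 1) * (f x - f y) ^ 2
      ≤ volume.real A * (f x - f y) ^ 2 := by
        exact mul_le_mul_of_nonneg_right (volume_ball_one_le_ball_three_diff d hd x y)
          (sq_nonneg _)
    _ = ∫ _ in A, (f x - f y) ^ 2 := by simp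
    _ ≤ ∫ z in A, 2 * (2 * r) ^ ((d : ℝ) + α) *
          (jumpDensity d α f x z + jumpDensity d α f y z) := by
        refine setIntegral_mono_on (integrableOn_const hAfin)
          (((hix.mono_set hAx).add (hiy.mono_set hAy)).const_mul _) hAm fun z hz => ?_
        nlinarith [hbound x hx z hz.1 (hAx hz), hbound y hy z hz.1 (hAy hz),
          sq_nonneg (f x - f z + (f y - f z))]
    _ = 2 * (2 * r) ^ ((d : ℝ) + α) *
          ((∫ z in A, jumpDensity d α f x z) + ∫ z in A, jumpDensity d α f y z) := by
        rw [integral_const_mul, integral_add (hix.mono_set hAx) (hiy.mono_set hAy)]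
    _ ≤ _ := by
        have hp : 0 ≤ 2 * (2 * r) ^ ((d : ℝ) + α) :=
          mul_nonneg zero_le_two (Real.rpow_nonneg (by linarith) _)
        exact mul_le_mul_of_nonneg_left (add_le_add
          (setIntegral_mono_set hix (Eventually.of_forall fun z => jumpDensity_nonneg ..)
            hAx.eventuallyLE)
          (setIntegral_mono_set hiy (Eventually.of_forall fun z => jumpDensity_nonneg ..)
            hAy.eventuallyLE)) hp

theorem formD_eq_integral_jumpDensity (d : ℕ) (α : ℝ) (V f : Ed d → ℝ) :
    formD d α V f =
      1 / 2 * ∫ x, (∫ y in {y | 1 < dist x y}, jumpDensity d α f x y) ∂(muV d V) :=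
  rfl

theorem rpow_le_mul_rpow_mul_Kfun_div_kfun (d : ℕ) (α : ℝ) {r : ℝ} (V : Ed d → ℝ)
    (hVloc : LocallyBounded d V) (hr : 3 < r) :
    (2 * r) ^ ((d : ℝ) + α) ≤
      2 ^ ((d : ℝ) + α) * (r ^ (2 * (d : ℝ) + α) * Kfun d V r / kfun d V r) := by
  obtain ⟨hk, hkK⟩ := kfun_pos_and_le_Kfun d V hVloc (by linarith : 0 ≤ r)
  rw [Real.mul_rpow (by norm_num) (by linarith)]
  gcongr
  rw [mul_div_assoc]
  calc r ^ ((d : ℝ) + α) ≤ r ^ (2 * (d : ℝ) + α) := by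
        refine Real.rpow_le_rpow_of_exponent_le (by linarith) ?_
        have : (0 : ℝ) ≤ d := by positivity
        linarith
    _ ≤ r ^ (2 * (d : ℝ) + α) * (Kfun d V r / kfun d V r) :=
        le_mul_of_one_le_right (Real.rpow_nonneg (by linarith) _) ((one_le_div hk).2 hkK)

theorem CbSmooth.abs_le_iSup {d : ℕ} {f : Ed d → ℝ} (hf : CbSmooth d f) (x : Ed d) :
    |f x| ≤ ⨆ y, |f y| := by
  obtain ⟨C, hC⟩ := hf.2 0
  refine le_ciSup (f := fun y => |f y|) ⟨C, ?_⟩ x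
  rintro _ ⟨y, rfl⟩
  simpa using hC y

/-- weak Poincaré inequality for `𝓓_{α,V}`. -/
theorem weak_poincare_formD
    (d : ℕ) (hd : 1 ≤ d) (α : ℝ) (hα : 0 < α ∧ α < 2)
    (V : Ed d → ℝ) (hVmeas : Measurable V) (hVloc : LocallyBounded d V)
    (hVint : Integrable (fun x => Real.exp (-V x))) :
    ∃ C₆ : ℝ, 0 < C₆ ∧ ∀ s : ℝ, 0 < s → ∀ f : Ed d → ℝ, CbSmooth d f →
      (∫ x, f x ∂(muV d V)) = 0 →
      ∫ x, (f x) ^ 2 ∂(muV d V) ≤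
        C₆ * alpha2 d α V s * formD d α V f + s * (⨆ x : Ed d, |f x|) ^ 2 := by
  have := muV_isProbabilityMeasure d V hVint
  set c := volume.real (ball (0 : Ed d) 1) with hc
  have hc0 : 0 < c := ENNReal.toReal_pos (measure_ball_pos _ _ one_pos).ne' measure_ball_lt_top.ne
  set C := 4 / c * 2 ^ ((d : ℝ) + α) with hC
  have hC0 : 0 < C := by positivity
  refine ⟨C, hC0, fun s hs f hf hf0 => ?_⟩
  set S := ⨆ x : Ed d, |f x|
  have hfS : ∀ x, |f x| ≤ S := hf.abs_le_iSup
  have hfm : Measurable f := hf.1.continuous.measurable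
  have hD0 : 0 ≤ formD d α V f := by
    rw [formD_eq_integral_jumpDensity]
    exact mul_nonneg (by norm_num)
      (integral_nonneg fun x => integral_nonneg fun y => jumpDensity_nonneg ..)
  have key : ∀ r : ℝ, 3 < r → muV d V ((ball (0 : Ed d) r)ᶜ) ≤ ENNReal.ofReal (s / (1 + s)) →
      ∫ x, (f x) ^ 2 ∂(muV d V) ≤ (r ^ (2 * (d : ℝ) + α) * Kfun d V r / kfun d V r) *
        (C * formD d α V f) + s * S ^ 2 := by
    intro r hr hμ
    have hcompl : (muV d V).real (ball (0 : Ed d) r)ᶜ ≤ s / (1 + s) :=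
      ENNReal.toReal_le_of_le_ofReal (by positivity) hμ
    have hadd := probReal_compl_eq_one_sub (μ := muV d V) (measurableSet_ball (x := (0 : Ed d))
      (ε := r))
    have hcompl' := (le_div_iff₀ (by positivity)).1 hcompl
    have hratio : (muV d V).real (ball (0 : Ed d) r)ᶜ ≤ s * (muV d V).real (ball (0 : Ed d) r) := by
      rw [hadd] at hcompl' ⊢
      linarith
    have hm : 0 < (muV d V).real (ball (0 : Ed d) r) := by
      by_contra h
      nlinarith [measureReal_nonneg (μ := muV d V) (s := ball (0 : Ed d) r)]
    have hp : 0 ≤ (2 * r) ^ ((d : ℝ) + α) := Real.rpow_nonneg (by linarith) _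
    refine (integral_sq_le_of_forall_mem_sq_sub_le measurableSet_ball hfm hfS hf0
      (integrable_setIntegral_jumpDensity d hα.1 hfm hfS _)
      (fun x => integral_nonneg fun y => jumpDensity_nonneg ..)
      (a := 2 * (2 * r) ^ ((d : ℝ) + α) / c) (by positivity) hm hratio
      fun x hx y hy => ?_).trans ?_
    · rw [div_mul_eq_mul_div, le_div_iff₀ hc0, mul_comm _ c]
      exact sq_sub_le_setIntegral_jumpDensity d hd hα.1 hr hfm hfS hx hy
    · have hform := formD_eq_integral_jumpDensity d α V f
      have hrpow := rpow_le_mul_rpow_mul_Kfun_div_kfun d α V hVloc hr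
      have hmul := mul_le_mul_of_nonneg_right hrpow
        (by positivity : 0 ≤ 4 / c * formD d α V f)
      have hJ : ∫ x, (∫ y in {y | 1 < dist x y}, jumpDensity d α f x y) ∂(muV d V) =
          2 * formD d α V f := by rw [hform]; ring
      rw [hJ]
      gcongr ?_ + _
      calc _ = (2 * r) ^ ((d : ℝ) + α) * (4 / c * formD d α V f) := by ring
        _ ≤ _ := hmul
        _ = _ := by rw [hC]; ring
  obtain ⟨r₀, hr₀, hμ₀⟩ := exists_lt_measure_compl_ball_le (muV d V) (0 : Ed d) 3
    (ε := ENNReal.ofReal (s / (1 + s))) (ENNReal.ofReal_pos.2 (by positivity))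
  rw [show C * alpha2 d α V s * formD d α V f = alpha2 d α V s * (C * formD d α V f) by ring]
  rcases hD0.eq_or_lt with hD | hD
  · simpa [← hD] using key r₀ hr₀ hμ₀
  · rw [← sub_le_iff_le_add, ← div_le_iff₀ (by positivity)]
    refine le_csInf (Set.Nonempty.image _ ⟨r₀, hr₀, hμ₀⟩) ?_
    rintro _ ⟨r, ⟨hr, hμ⟩, rfl⟩
    rw [div_le_iff₀ (by positivity), sub_le_iff_le_add]
    exact key r hr hμ
end
end

section
/- Suppose that liminf_{|x|→∞} [ inf_{z: |x|−1 ≤ |z| ≤ |x|−1/2} e^{−V(z)} ] / [ sup_{z: |x| ≤ |z| ≤ |x|+1} e^{−V(z)} ] > (1/α)·2^{2d+1}·(e + e^{1/2})·(2^α − 1). Then there exists a constant C₁ > 0 such that the weighted Poincaré inequality ∫ f(x)² ( e^{V(x)} · inf_{z: |x|−1 ≤ |z| ≤ |x|−1/2} e^{−V(z)} ) μ_V(dx) ≤ C₁ · 𝓔_{α,V}(f,f) holds for every f ∈ C_b^∞(ℝ^d) with μ_V(f) = 0. -/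
open MeasureTheory Real Set Metric Filter

noncomputable section

/-- Points at distance at most one from `x`, and closer to the origin than `x` by at least `1/2`
(except that the ball of radius `1/2` is always allowed). -/
def inwardNbhd (d : ℕ) (x : Ed d) : Set (Ed d) :=
  {y | dist y x ≤ 1 ∧ ‖y‖ ≤ max (1/2) (‖x‖ - 1/2)}

/-- The mass that the density `ψ` puts on the inward neighbourhood of `x`. -/
def inwardMass (d : ℕ) (ψ : Ed d → ENNReal) (x : Ed d) : ENNReal :=
  ∫⁻ y in inwardNbhd d x, ψ y

/-- The unit range jump energy of `g` with density `ψ` and flat jump kernel. -/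
def flatEnergy (d : ℕ) (ψ : Ed d → ENNReal) (g : Ed d → ℝ) : ENNReal :=
  ∫⁻ x, ∫⁻ y in closedBall x 1, ENNReal.ofReal ((g x - g y) ^ 2) * ψ x

lemma measurableSet_mem_inwardNbhd (d : ℕ) :
    MeasurableSet {p : Ed d × Ed d | p.2 ∈ inwardNbhd d p.1} := by
  have : IsClosed ({p : Ed d × Ed d | dist p.2 p.1 ≤ 1} ∩
      {p : Ed d × Ed d | ‖p.2‖ ≤ max (1/2) (‖p.1‖ - 1/2)}) :=
    (isClosed_le (by fun_prop) (by fun_prop)).inter (isClosed_le (by fun_prop) (by fun_prop))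
  exact this.measurableSet

lemma measurableSet_inwardNbhd (d : ℕ) (x : Ed d) : MeasurableSet (inwardNbhd d x) :=
  measurable_prodMk_left (measurableSet_mem_inwardNbhd d)

lemma inwardNbhd_subset_closedBall (d : ℕ) (x : Ed d) :
    inwardNbhd d x ⊆ closedBall x 1 := fun _ hy => hy.1

lemma exists_closedBall_subset_inwardNbhd (d : ℕ) (x : Ed d) :
    ∃ p, closedBall p (1/4) ⊆ inwardNbhd d x := by
  rcases le_or_gt ‖x‖ 1 with h | h
  · refine ⟨(1/4 : ℝ) • x, fun y hy => ?_⟩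
    have h1 : ‖y - (1/4 : ℝ) • x‖ ≤ 1/4 := by rwa [← dist_eq_norm]
    have h2 : ‖(1/4 : ℝ) • x‖ ≤ 1/4 := by
      rw [norm_smul]; norm_num; linarith
    have h3 : ‖(3/4 : ℝ) • x‖ ≤ 3/4 := by
      rw [norm_smul]; norm_num; linarith
    constructor
    · rw [dist_eq_norm, show y - x = (y - (1/4 : ℝ) • x) - (3/4 : ℝ) • x by module]
      linarith [norm_sub_le (y - (1/4 : ℝ) • x) ((3/4 : ℝ) • x)]
    · refine le_trans ?_ (le_max_left _ _)
      have := norm_add_le (y - (1/4 : ℝ) • x) ((1/4 : ℝ) • x)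
      rw [sub_add_cancel] at this
      linarith
  · have hx : 0 < ‖x‖ := by linarith
    set t : ℝ := 3 / 4 / ‖x‖ with ht
    have htx : t * ‖x‖ = 3/4 := by rw [ht]; field_simp
    have ht0 : 0 ≤ t := by positivity
    have ht1 : t ≤ 1 := by rw [ht, div_le_one hx]; linarith
    refine ⟨(1 - t) • x, fun y hy => ?_⟩
    have h1 : ‖y - (1 - t) • x‖ ≤ 1/4 := by rwa [← dist_eq_norm]
    have h2 : ‖(1 - t) • x‖ = ‖x‖ - 3/4 := by
      rw [norm_smul, Real.norm_of_nonneg (by linarith), ← htx]; ring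
    have h3 : ‖t • x‖ = 3/4 := by rw [norm_smul, Real.norm_of_nonneg ht0, htx]
    constructor
    · rw [dist_eq_norm, show y - x = (y - (1 - t) • x) - t • x by module]
      linarith [norm_sub_le (y - (1 - t) • x) (t • x)]
    · refine le_trans ?_ (le_max_right _ _)
      have := norm_add_le (y - (1 - t) • x) ((1 - t) • x)
      rw [sub_add_cancel] at this
      linarith

lemma volume_closedBall_le_volume_inwardNbhd (d : ℕ) (x : Ed d) :
    volume (closedBall (0 : Ed d) (1/4)) ≤ volume (inwardNbhd d x) := by
  obtain ⟨p, hp⟩ := exists_closedBall_subset_inwardNbhd d x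
  rw [← Measure.addHaar_closedBall_center volume p]
  exact measure_mono hp

lemma measurable_inwardMass (d : ℕ) {ψ : Ed d → ENNReal} (hψ : Measurable ψ) :
    Measurable (inwardMass d ψ) := by
  have hm : Measurable ({p : Ed d × Ed d | p.2 ∈ inwardNbhd d p.1}.indicator
      fun p => ψ p.2) := (hψ.comp measurable_snd).indicator (measurableSet_mem_inwardNbhd d)
  have he : inwardMass d ψ = fun x => ∫⁻ y,
      ({p : Ed d × Ed d | p.2 ∈ inwardNbhd d p.1}.indicator fun p => ψ p.2) (x, y) := by
    funext x
    rw [inwardMass, ← lintegral_indicator (measurableSet_inwardNbhd d x)]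
    rfl
  rw [he]
  exact hm.lintegral_prod_right'

lemma measurableSet_dist_le_one (d : ℕ) :
    MeasurableSet {p : Ed d × Ed d | p.2 ∈ closedBall p.1 1} := by
  have : IsClosed {p : Ed d × Ed d | dist p.2 p.1 ≤ 1} :=
    isClosed_le (by fun_prop) (by fun_prop)
  exact this.measurableSet

lemma setLIntegral_closedBall_eq (d : ℕ) (F : Ed d → Ed d → ENNReal) (x : Ed d) :
    ∫⁻ y in closedBall x 1, F x y =
      ∫⁻ y, ({p : Ed d × Ed d | p.2 ∈ closedBall p.1 1}.indicator
        (Function.uncurry F)) (x, y) := by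
  rw [← lintegral_indicator measurableSet_closedBall]
  rfl

lemma measurable_setLIntegral_closedBall (d : ℕ) {F : Ed d → Ed d → ENNReal}
    (hF : Measurable (Function.uncurry F)) :
    Measurable fun x => ∫⁻ y in closedBall x 1, F x y := by
  simp_rw [setLIntegral_closedBall_eq]
  exact (hF.indicator (measurableSet_dist_le_one d)).lintegral_prod_right'

lemma lintegral_closedBall_swap (d : ℕ) {F : Ed d → Ed d → ENNReal}
    (hF : Measurable (Function.uncurry F)) :
    ∫⁻ x, ∫⁻ y in closedBall x 1, F x y = ∫⁻ x, ∫⁻ y in closedBall x 1, F y x := by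
  simp_rw [setLIntegral_closedBall_eq]
  rw [lintegral_lintegral_swap (f := fun x y =>
    ({p : Ed d × Ed d | p.2 ∈ closedBall p.1 1}.indicator (Function.uncurry F)) (x, y))
    (hF.indicator (measurableSet_dist_le_one d)).aemeasurable]
  refine lintegral_congr fun x => ?_
  rw [setLIntegral_closedBall_eq d (fun x y => F y x) x]
  refine lintegral_congr fun y => ?_
  simp only [indicator, mem_ofPred_eq, mem_closedBall, Function.uncurry, dist_comm x y]

lemma lintegral_closedBall_snd (d : ℕ) {h : Ed d → ENNReal} (hh : Measurable h) :
    ∫⁻ x, ∫⁻ y in closedBall x 1, h y = volume (closedBall (0 : Ed d) 1) * ∫⁻ x, h x := by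
  rw [lintegral_closedBall_swap d (F := fun _ y => h y) (hh.comp measurable_snd)]
  simp_rw [setLIntegral_const, Measure.addHaar_closedBall_center volume]
  rw [lintegral_mul_const _ hh, mul_comm]

lemma ofReal_sq_le_two_mul (a b : ℝ) :
    ENNReal.ofReal (a ^ 2) ≤ 2 * ENNReal.ofReal ((a - b) ^ 2) + 2 * ENNReal.ofReal (b ^ 2) := by
  rw [← ENNReal.ofReal_ofNat 2, ← ENNReal.ofReal_mul (by norm_num),
    ← ENNReal.ofReal_mul (by norm_num), ← ENNReal.ofReal_add (by positivity) (by positivity)]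
  exact ENNReal.ofReal_le_ofReal (by nlinarith [sq_nonneg (a - 2 * b)])

/-- The mass of `g²` is transported inwards, at the cost of the jump energy. -/
lemma setLIntegral_sq_mul_inwardMass_le (d : ℕ) {ψ : Ed d → ENNReal} (hψ : Measurable ψ)
    {g : Ed d → ℝ} (hg : Measurable g) {X S : Set (Ed d)} (hX : MeasurableSet X)
    (hS : MeasurableSet S) (hXS : ∀ x ∈ X, inwardNbhd d x ⊆ S) :
    ∫⁻ x in X, ENNReal.ofReal (g x ^ 2) * inwardMass d ψ x ≤
      2 * flatEnergy d ψ g +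
        2 * volume (closedBall (0 : Ed d) 1) * ∫⁻ y in S, ENNReal.ofReal (g y ^ 2) * ψ y := by
  set h : Ed d → ENNReal := S.indicator fun y => ENNReal.ofReal (g y ^ 2) * ψ y with hh
  have hhm : Measurable h := by
    refine Measurable.indicator ?_ hS
    fun_prop
  have hFm : Measurable (Function.uncurry fun x y : Ed d =>
      ENNReal.ofReal ((g x - g y) ^ 2) * ψ y) := by
    unfold Function.uncurry; fun_prop
  have hpt : ∀ x ∈ X, ENNReal.ofReal (g x ^ 2) * inwardMass d ψ x ≤
      2 * (∫⁻ y in closedBall x 1, ENNReal.ofReal ((g x - g y) ^ 2) * ψ y) +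
        2 * ∫⁻ y in closedBall x 1, h y := by
    intro x hx
    rw [inwardMass, ← lintegral_const_mul _ hψ, ← lintegral_const_mul _ (by fun_prop),
      ← lintegral_const_mul _ hhm, ← lintegral_add_right _ (by fun_prop)]
    refine (setLIntegral_mono' (measurableSet_inwardNbhd d x) fun y hy => ?_).trans
      (lintegral_mono_set (inwardNbhd_subset_closedBall d x))
    rw [hh, indicator_of_mem (hXS x hx hy), ← mul_assoc, ← mul_assoc, ← add_mul]
    gcongr
    exact ofReal_sq_le_two_mul _ _
  calc ∫⁻ x in X, ENNReal.ofReal (g x ^ 2) * inwardMass d ψ x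
      ≤ ∫⁻ x in X, (2 * (∫⁻ y in closedBall x 1, ENNReal.ofReal ((g x - g y) ^ 2) * ψ y) +
        2 * ∫⁻ y in closedBall x 1, h y) := setLIntegral_mono' hX hpt
    _ ≤ ∫⁻ x, (2 * (∫⁻ y in closedBall x 1, ENNReal.ofReal ((g x - g y) ^ 2) * ψ y) +
        2 * ∫⁻ y in closedBall x 1, h y) := setLIntegral_le_lintegral _ _
    _ = 2 * flatEnergy d ψ g + 2 * volume (closedBall (0 : Ed d) 1) *
          ∫⁻ y in S, ENNReal.ofReal (g y ^ 2) * ψ y := by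
      have hm1 := measurable_setLIntegral_closedBall d hFm
      have hm2 := measurable_setLIntegral_closedBall d (F := fun _ y => h y)
        (hhm.comp measurable_snd)
      rw [lintegral_add_left (hm1.const_mul 2), lintegral_const_mul _ hm1,
        lintegral_const_mul _ hm2, lintegral_closedBall_snd d hhm,
        lintegral_closedBall_swap d hFm, hh, lintegral_indicator hS, flatEnergy, mul_assoc]
      congr 4 with x
      refine lintegral_congr fun y => ?_
      rw [← neg_sub, neg_sq]

lemma mul_volume_le_inwardMass (d : ℕ) {ψ : Ed d → ENNReal} {x : Ed d} {k : ENNReal}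
    (h : ∀ y ∈ inwardNbhd d x, k ≤ ψ y) :
    k * volume (closedBall (0 : Ed d) (1/4)) ≤ inwardMass d ψ x := by
  calc k * volume (closedBall (0 : Ed d) (1/4))
      ≤ k * volume (inwardNbhd d x) := by
        exact mul_le_mul_right (volume_closedBall_le_volume_inwardNbhd d x) k
    _ = ∫⁻ _ in inwardNbhd d x, k := (setLIntegral_const _ _).symm
    _ ≤ inwardMass d ψ x := setLIntegral_mono' (measurableSet_inwardNbhd d x) h

lemma lintegral_inwardMass_le (d : ℕ) {ψ : Ed d → ENNReal} (hψ : Measurable ψ) :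
    ∫⁻ x, inwardMass d ψ x ≤ volume (closedBall (0 : Ed d) 1) * ∫⁻ x, ψ x := by
  rw [← lintegral_closedBall_snd d hψ]
  exact lintegral_mono fun x => lintegral_mono_set (inwardNbhd_subset_closedBall d x)

lemma volume_closedBall_zero_pos (d : ℕ) {r : ℝ} (hr : 0 < r) :
    volume (closedBall (0 : Ed d) r) ≠ 0 :=
  (measure_closedBall_pos volume _ hr).ne'

lemma volume_closedBall_zero_ne_top (d : ℕ) (r : ℝ) : volume (closedBall (0 : Ed d) r) ≠ ⊤ :=
  measure_closedBall_lt_top.ne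

/-- Chaining: on any ball, `g²` is controlled by the energy and by `g²` on the ball of
radius `1/2`. -/
lemma exists_setLIntegral_ball_sq_le (d : ℕ) {ψ : Ed d → ENNReal} (hψ : Measurable ψ)
    (hloc : ∀ r : ℝ, ∃ k K : ENNReal, k ≠ 0 ∧ K ≠ ⊤ ∧
      ∀ x : Ed d, ‖x‖ ≤ r → k ≤ ψ x ∧ ψ x ≤ K) (n : ℕ) :
    ∃ C : ENNReal, C ≠ ⊤ ∧ ∀ g : Ed d → ℝ, Measurable g →
      ∫⁻ x in closedBall 0 (1/2 + n/2), ENNReal.ofReal (g x ^ 2) * ψ x ≤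
        C * (flatEnergy d ψ g +
          ∫⁻ x in closedBall 0 (1/2), ENNReal.ofReal (g x ^ 2) * ψ x) := by
  induction n with
  | zero => exact ⟨1, by simp, fun g _ => by simp⟩
  | succ n ih =>
    obtain ⟨C, hC, hCg⟩ := ih
    obtain ⟨k, K, hk, hK, hkK⟩ := hloc (1/2 + (n + 1 : ℕ) / 2)
    set v := volume (closedBall (0 : Ed d) 1)
    set b := volume (closedBall (0 : Ed d) (1/4))
    have hv : v ≠ ⊤ := volume_closedBall_zero_ne_top d 1
    have hb : b ≠ ⊤ := volume_closedBall_zero_ne_top d _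
    have hb0 : b ≠ 0 := volume_closedBall_zero_pos d (by norm_num)
    have hkt : k ≠ ⊤ := ne_top_of_le_ne_top hK
      ((hkK 0 (by rw [norm_zero]; positivity)).1.trans (hkK 0 (by rw [norm_zero]; positivity)).2)
    have hkb0 : k * b ≠ 0 := mul_ne_zero hk hb0
    have hkbt : k * b ≠ ⊤ := ENNReal.mul_ne_top hkt hb
    refine ⟨K / (k * b) * (2 + 2 * v * C), ?_, fun g hg => ?_⟩
    · exact ENNReal.mul_ne_top (ENNReal.div_ne_top hK hkb0) (by finiteness)
    have hsub : ∀ x ∈ closedBall (0 : Ed d) (1/2 + (n + 1 : ℕ) / 2),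
        inwardNbhd d x ⊆ closedBall 0 (1/2 + n/2) := by
      intro x hx y hy
      rw [mem_closedBall_zero_iff] at hx ⊢
      refine hy.2.trans (max_le ?_ ?_)
      · have : (0 : ℝ) ≤ n := n.cast_nonneg
        linarith
      · push_cast at hx
        linarith
    have hψJ : ∀ x ∈ closedBall (0 : Ed d) (1/2 + (n + 1 : ℕ) / 2),
        ψ x ≤ K / (k * b) * inwardMass d ψ x := by
      intro x hx
      calc ψ x ≤ K := (hkK x (by simpa using hx)).2
        _ = K / (k * b) * (k * b) := (ENNReal.div_mul_cancel hkb0 hkbt).symm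
        _ ≤ _ := by
          gcongr
          refine mul_volume_le_inwardMass d fun y hy => (hkK y ?_).1
          have := hsub x hx hy
          rw [mem_closedBall_zero_iff] at this
          push_cast
          linarith
    calc ∫⁻ x in closedBall 0 (1/2 + (n + 1 : ℕ) / 2), ENNReal.ofReal (g x ^ 2) * ψ x
        ≤ ∫⁻ x in closedBall 0 (1/2 + (n + 1 : ℕ) / 2),
            K / (k * b) * (ENNReal.ofReal (g x ^ 2) * inwardMass d ψ x) := by
          refine setLIntegral_mono' measurableSet_closedBall fun x hx => ?_
          rw [mul_left_comm]
          gcongr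
          exact hψJ x hx
      _ = K / (k * b) * ∫⁻ x in closedBall 0 (1/2 + (n + 1 : ℕ) / 2),
            ENNReal.ofReal (g x ^ 2) * inwardMass d ψ x := by
          have := measurable_inwardMass d hψ
          rw [lintegral_const_mul _ (by fun_prop)]
      _ ≤ K / (k * b) * (2 * flatEnergy d ψ g + 2 * v *
            ∫⁻ y in closedBall 0 (1/2 + n/2), ENNReal.ofReal (g y ^ 2) * ψ y) := by
          gcongr
          exact setLIntegral_sq_mul_inwardMass_le d hψ hg measurableSet_closedBall
            measurableSet_closedBall hsub
      _ ≤ K / (k * b) * (2 * (flatEnergy d ψ g +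
            ∫⁻ x in closedBall 0 (1/2), ENNReal.ofReal (g x ^ 2) * ψ x) + 2 * v *
            (C * (flatEnergy d ψ g +
              ∫⁻ x in closedBall 0 (1/2), ENNReal.ofReal (g x ^ 2) * ψ x))) := by
          gcongr
          · exact le_self_add
          · exact hCg g hg
      _ = _ := by ring

lemma flatEnergy_sub_const (d : ℕ) (ψ : Ed d → ENNReal) (f : Ed d → ℝ) (m : ℝ) :
    flatEnergy d ψ (fun x => f x - m) = flatEnergy d ψ f := by
  simp [flatEnergy]

lemma exists_const_setLIntegral_half_ball_le (d : ℕ) {ψ : Ed d → ENNReal} (hψ : Measurable ψ)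
    {f : Ed d → ℝ} (hf : Measurable f) :
    ∃ m : ℝ, ∫⁻ x in closedBall 0 (1/2), ENNReal.ofReal ((f x - m) ^ 2) * ψ x ≤
      (volume (closedBall (0 : Ed d) (1/2)))⁻¹ * flatEnergy d ψ f := by
  have hFm : Measurable (Function.uncurry fun y x : Ed d =>
      ENNReal.ofReal ((f x - f y) ^ 2) * ψ x) := by
    unfold Function.uncurry; fun_prop
  have hB0 := volume_closedBall_zero_pos d (r := 1/2) (by norm_num)
  have hBt := volume_closedBall_zero_ne_top d (1/2)
  obtain ⟨y, -, hy⟩ := exists_le_setLAverage (μ := volume) (s := closedBall (0 : Ed d) (1/2))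
    (f := fun y => ∫⁻ x in closedBall 0 (1/2), ENNReal.ofReal ((f x - f y) ^ 2) * ψ x)
    hB0 hBt hFm.lintegral_prod_right'.aemeasurable
  refine ⟨f y, hy.trans ?_⟩
  rw [setLAverage_eq, ENNReal.div_eq_inv_mul]
  gcongr
  rw [flatEnergy, lintegral_closedBall_swap d (by unfold Function.uncurry; fun_prop)]
  refine le_trans (setLIntegral_mono' measurableSet_closedBall fun y hy => ?_)
    (setLIntegral_le_lintegral _ _)
  refine lintegral_mono_set fun x hx => ?_
  rw [mem_closedBall_zero_iff] at hx hy
  rw [mem_closedBall, dist_eq_norm]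
  linarith [norm_sub_le x y]

lemma ENNReal.le_two_mul_of_le_add_half {F A : ENNReal} (hF : F ≠ ⊤) (h : F ≤ A + F / 2) :
    F ≤ 2 * A := by
  have h2 : F / 2 ≤ A := by
    refine (ENNReal.add_le_add_iff_right (ENNReal.div_ne_top hF two_ne_zero)).1 ?_
    rwa [ENNReal.add_halves]
  calc F = 2 * (F / 2) := (ENNReal.mul_div_cancel (by norm_num) (by norm_num)).symm
    _ ≤ 2 * A := by gcongr

/-- Outside a ball where the inward mass dominates the density, the inward mass
controls `g²` by the energy and the local mass. -/
lemma setLIntegral_compl_ball_sq_mul_inwardMass_le (d : ℕ) {ψ : Ed d → ENNReal}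
    (hψ : Measurable ψ) (hint : ∫⁻ x, ψ x ≠ ⊤) {R : ℝ}
    (htail : ∀ x ∈ (closedBall (0 : Ed d) R)ᶜ,
      4 * volume (closedBall (0 : Ed d) 1) * ψ x ≤ inwardMass d ψ x)
    {g : Ed d → ℝ} (hg : Measurable g) {M : ℝ} (hM : ∀ x, |g x| ≤ M) :
    ∫⁻ x in (closedBall 0 R)ᶜ, ENNReal.ofReal (g x ^ 2) * inwardMass d ψ x ≤
      4 * flatEnergy d ψ g + 4 * volume (closedBall (0 : Ed d) 1) *
        ∫⁻ x in closedBall 0 R, ENNReal.ofReal (g x ^ 2) * ψ x := by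
  set v := volume (closedBall (0 : Ed d) 1)
  have hv : v ≠ ⊤ := volume_closedBall_zero_ne_top d 1
  have hJm := measurable_inwardMass d hψ
  set F := ∫⁻ x in (closedBall 0 R)ᶜ, ENNReal.ofReal (g x ^ 2) * inwardMass d ψ x
  have hFt : F ≠ ⊤ := by
    refine ne_top_of_le_ne_top (b := ENNReal.ofReal (M ^ 2) * (v * ∫⁻ x, ψ x))
      (by finiteness) ?_
    calc F ≤ ∫⁻ x, ENNReal.ofReal (M ^ 2) * inwardMass d ψ x := by
          refine (setLIntegral_le_lintegral _ _).trans (lintegral_mono fun x => ?_)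
          gcongr ENNReal.ofReal ?_ * _
          exact sq_le_sq.2 ((hM x).trans (le_abs_self M))
      _ ≤ _ := by
          rw [lintegral_const_mul _ hJm]
          gcongr
          exact lintegral_inwardMass_le d hψ
  have htail' : 2 * v * ∫⁻ x in (closedBall 0 R)ᶜ, ENNReal.ofReal (g x ^ 2) * ψ x ≤ F / 2 := by
    rw [ENNReal.le_div_iff_mul_le (by norm_num) (by norm_num), mul_right_comm,
      show 2 * v * 2 = 4 * v by ring, ← lintegral_const_mul _ (by fun_prop)]
    refine setLIntegral_mono' measurableSet_closedBall.compl fun x hx => ?_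
    rw [mul_left_comm]
    gcongr
    exact htail x hx
  have hmain := setLIntegral_sq_mul_inwardMass_le d hψ hg
    (measurableSet_closedBall (x := (0 : Ed d)) (ε := R)).compl MeasurableSet.univ
    fun _ _ => subset_univ _
  rw [Measure.restrict_univ,
    ← lintegral_add_compl (fun y => ENNReal.ofReal (g y ^ 2) * ψ y)
      (measurableSet_closedBall (x := (0 : Ed d)) (ε := R)),
    mul_add, ← add_assoc] at hmain
  refine (ENNReal.le_two_mul_of_le_add_half hFt (hmain.trans (by gcongr))).trans_eq ?_
  ring

/-- Weighted Poincaré inequality up to a constant, for a general density. -/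
theorem exists_const_lintegral_sq_mul_le (d : ℕ) {ψ : Ed d → ENNReal}
    (hψ : Measurable ψ) (hint : ∫⁻ x, ψ x ≠ ⊤)
    (hloc : ∀ r : ℝ, ∃ k K : ENNReal, k ≠ 0 ∧ K ≠ ⊤ ∧
      ∀ x : Ed d, ‖x‖ ≤ r → k ≤ ψ x ∧ ψ x ≤ K) (n : ℕ)
    (htail : ∀ x ∈ (closedBall (0 : Ed d) (1/2 + n/2))ᶜ,
      4 * volume (closedBall (0 : Ed d) 1) * ψ x ≤ inwardMass d ψ x) :
    ∃ C : ENNReal, C ≠ ⊤ ∧ ∀ f : Ed d → ℝ, Measurable f → (∃ M, ∀ x, |f x| ≤ M) →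
      ∃ m : ℝ, ∫⁻ x, ENNReal.ofReal ((f x - m) ^ 2) *
        (ψ x + (closedBall 0 (1/2 + n/2))ᶜ.indicator (inwardMass d ψ) x) ≤
          C * flatEnergy d ψ f := by
  obtain ⟨C, hC, hCg⟩ := exists_setLIntegral_ball_sq_le d hψ hloc n
  set R : ℝ := 1/2 + n/2
  set v := volume (closedBall (0 : Ed d) 1)
  set u := volume (closedBall (0 : Ed d) (1/2))
  have hv : v ≠ ⊤ := volume_closedBall_zero_ne_top d 1
  have hv0 : v ≠ 0 := volume_closedBall_zero_pos d one_pos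
  have hu0 : u ≠ 0 := volume_closedBall_zero_pos d (by norm_num)
  have h4v0 : 4 * v ≠ 0 := mul_ne_zero (by norm_num) hv0
  have h4vt : 4 * v ≠ ⊤ := by finiteness
  have hJm := measurable_inwardMass d hψ
  have hBm : MeasurableSet (closedBall (0 : Ed d) R) := measurableSet_closedBall
  refine ⟨C * (1 + u⁻¹) + ((4 * v)⁻¹ + 1) * (4 + 4 * v * (C * (1 + u⁻¹))), ?_, ?_⟩
  · have := ENNReal.inv_ne_top.2 hu0
    have := ENNReal.inv_ne_top.2 h4v0
    finiteness
  rintro f hf ⟨M, hM⟩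
  obtain ⟨m, hm⟩ := exists_const_setLIntegral_half_ball_le d hψ hf
  refine ⟨m, ?_⟩
  set g : Ed d → ℝ := fun x => f x - m
  have hgm : Measurable g := by fun_prop
  have hgE : flatEnergy d ψ g = flatEnergy d ψ f := flatEnergy_sub_const d ψ f m
  have hlocal : ∫⁻ x in closedBall 0 R, ENNReal.ofReal (g x ^ 2) * ψ x ≤
      C * (1 + u⁻¹) * flatEnergy d ψ f := by
    refine (hCg g hgm).trans ?_
    rw [mul_assoc, add_mul, one_mul, hgE]
    gcongr
  have hout := setLIntegral_compl_ball_sq_mul_inwardMass_le d hψ hint htail hgm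
    (M := M + |m|) fun x => (abs_sub _ _).trans (by gcongr; exact hM x)
  have hψout : ∫⁻ x in (closedBall 0 R)ᶜ, ENNReal.ofReal (g x ^ 2) * ψ x ≤
      (4 * v)⁻¹ * ∫⁻ x in (closedBall 0 R)ᶜ, ENNReal.ofReal (g x ^ 2) * inwardMass d ψ x := by
    rw [← lintegral_const_mul _ (by fun_prop)]
    refine setLIntegral_mono' hBm.compl fun x hx => ?_
    rw [mul_left_comm]
    gcongr
    rw [← ENNReal.div_eq_inv_mul, ENNReal.le_div_iff_mul_le (Or.inl h4v0) (Or.inl h4vt), mul_comm]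
    exact htail x hx
  have hsplit : ∫⁻ x, ENNReal.ofReal (g x ^ 2) *
      (ψ x + (closedBall 0 R)ᶜ.indicator (inwardMass d ψ) x) =
      (∫⁻ x in closedBall 0 R, ENNReal.ofReal (g x ^ 2) * ψ x) +
      (∫⁻ x in (closedBall 0 R)ᶜ, ENNReal.ofReal (g x ^ 2) * ψ x) +
      ∫⁻ x in (closedBall 0 R)ᶜ, ENNReal.ofReal (g x ^ 2) * inwardMass d ψ x := by
    rw [lintegral_add_compl _ hBm, ← lintegral_indicator hBm.compl,
      ← lintegral_add_left (by fun_prop)]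
    refine lintegral_congr fun x => ?_
    rw [mul_add, indicator_mul_right]
  rw [hsplit]
  calc _ ≤ C * (1 + u⁻¹) * flatEnergy d ψ f +
        (4 * v)⁻¹ * (4 * flatEnergy d ψ f + 4 * v * (C * (1 + u⁻¹) * flatEnergy d ψ f)) +
        (4 * flatEnergy d ψ f + 4 * v * (C * (1 + u⁻¹) * flatEnergy d ψ f)) := by
        have hout' := hout.trans (b := 4 * flatEnergy d ψ g + 4 * v * _)
          (c := 4 * flatEnergy d ψ f + 4 * v * (C * (1 + u⁻¹) * flatEnergy d ψ f)) (by
            rw [hgE]; gcongr)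
        gcongr
        exact hψout.trans (by gcongr)
    _ = _ := by ring

lemma infAnn_le {d : ℕ} {V : Ed d → ℝ} {x z : Ed d} (h1 : ‖x‖ - 1 ≤ ‖z‖)
    (h2 : ‖z‖ ≤ ‖x‖ - 1/2) : infAnn d V x ≤ Real.exp (-V z) :=
  csInf_le ⟨0, by rintro _ ⟨z, -, rfl⟩; positivity⟩ ⟨z, ⟨h1, h2⟩, rfl⟩

lemma infAnn_le_of_mem_inwardNbhd {d : ℕ} {V : Ed d → ℝ} {x y : Ed d} (hx : 1 ≤ ‖x‖)
    (hy : y ∈ inwardNbhd d x) : infAnn d V x ≤ Real.exp (-V y) := by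
  refine infAnn_le ?_ (hy.2.trans (max_le (by linarith) le_rfl))
  have h := hy.1
  rw [dist_eq_norm] at h
  linarith [norm_sub_norm_le x y, norm_sub_rev x y]

lemma infAnn_le_exp {d : ℕ} {V : Ed d → ℝ} {r M : ℝ} (hM : ∀ x : Ed d, ‖x‖ ≤ r → |V x| ≤ M)
    {x : Ed d} (hx : ‖x‖ ≤ r) : infAnn d V x ≤ Real.exp M := by
  rcases Set.eq_empty_or_nonempty {z : Ed d | ‖x‖ - 1 ≤ ‖z‖ ∧ ‖z‖ ≤ ‖x‖ - 1/2}
    with h | ⟨z, h1, h2⟩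
  · rw [infAnn, h, image_empty, Real.sInf_empty]
    positivity
  · refine (infAnn_le h1 h2).trans (Real.exp_le_exp.2 ?_)
    linarith [neg_abs_le (V z), hM z (by linarith)]

lemma exp_le_supAnn {d : ℕ} {V : Ed d → ℝ} (hV : LocallyBounded d V) (x : Ed d) :
    Real.exp (-V x) ≤ supAnn d V x := by
  obtain ⟨M, hM⟩ := hV (‖x‖ + 1)
  refine le_csSup ⟨Real.exp M, ?_⟩ ⟨x, ⟨le_rfl, by linarith⟩, rfl⟩
  rintro _ ⟨z, hz, rfl⟩
  exact Real.exp_le_exp.2 (by linarith [neg_abs_le (V z), hM z hz.2])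

lemma four_mul_pow_le_thresholdConst (d : ℕ) {α : ℝ} (hα : 0 < α) :
    4 * 4 ^ d ≤ thresholdConst d α := by
  have h1 : (2.7 : ℝ) ≤ Real.exp 1 := by linarith [Real.exp_one_gt_d9]
  have h2 : (1.5 : ℝ) ≤ Real.exp (1/2) := by linarith [Real.add_one_le_exp (1/2 : ℝ)]
  have h3 : α * 0.69 ≤ (2 : ℝ) ^ α - 1 := by
    rw [Real.rpow_def_of_pos two_pos]
    nlinarith [Real.add_one_le_exp (Real.log 2 * α), Real.log_two_gt_d9]
  have h4 : (0.69 : ℝ) ≤ 1 / α * ((2 : ℝ) ^ α - 1) := by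
    rw [one_div, ← div_eq_inv_mul, le_div_iff₀ hα]
    linarith
  have h5 : (2 : ℝ) ≤ (Real.exp 1 + Real.exp (1/2)) * (1 / α * ((2 : ℝ) ^ α - 1)) := by
    nlinarith
  have h6 : (2 : ℝ) ^ (2 * d + 1) = 2 * 4 ^ d := by
    rw [pow_succ, pow_mul]; norm_num; ring
  calc (4 : ℝ) * 4 ^ d = 2 * 4 ^ d * 2 := by ring
    _ ≤ 2 * 4 ^ d * ((Real.exp 1 + Real.exp (1/2)) * (1 / α * ((2 : ℝ) ^ α - 1))) := by gcongr
    _ = thresholdConst d α := by rw [thresholdConst, h6]; ring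

lemma four_mul_volume_mul_le_inwardMass {d : ℕ} {V : Ed d → ℝ} (hV : LocallyBounded d V)
    {c : ℝ} (hc : 4 * 4 ^ d ≤ c) {x : Ed d} (hx : 1 ≤ ‖x‖)
    (h : c ≤ infAnn d V x / supAnn d V x) :
    4 * volume (closedBall (0 : Ed d) 1) * ENNReal.ofReal (Real.exp (-V x)) ≤
      inwardMass d (fun y => ENNReal.ofReal (Real.exp (-V y))) x := by
  have hS := exp_le_supAnn hV x
  have hS0 : 0 < supAnn d V x := (Real.exp_pos _).trans_le hS
  rw [le_div_iff₀ hS0] at h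
  have hI : 4 * 4 ^ d * Real.exp (-V x) ≤ infAnn d V x :=
    (mul_le_mul hc hS (Real.exp_pos _).le ((by positivity : (0 : ℝ) ≤ 4 * 4 ^ d).trans hc)).trans h
  calc _ = ENNReal.ofReal (4 * 4 ^ d * Real.exp (-V x)) *
        (ENNReal.ofReal ((1/4) ^ d) * volume (closedBall (0 : Ed d) 1)) := by
        rw [← mul_assoc, ← ENNReal.ofReal_mul (by positivity),
          show (4 * 4 ^ d * Real.exp (-V x)) * (1/4 : ℝ) ^ d = 4 * Real.exp (-V x) by
            rw [mul_right_comm, mul_assoc 4, ← mul_pow]; norm_num,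
          ENNReal.ofReal_mul (by norm_num), ENNReal.ofReal_ofNat]
        ring
    _ = ENNReal.ofReal (4 * 4 ^ d * Real.exp (-V x)) * volume (closedBall (0 : Ed d) (1/4)) := by
        rw [Measure.addHaar_closedBall' volume (0 : Ed d) (r := 1/4) (by norm_num),
          finrank_euclideanSpace_fin]
    _ ≤ _ := mul_volume_le_inwardMass d fun y hy =>
        ENNReal.ofReal_le_ofReal (hI.trans (infAnn_le_of_mem_inwardNbhd hx hy))

lemma LocallyBounded.exists_bounds {d : ℕ} {V : Ed d → ℝ} (hV : LocallyBounded d V) (r : ℝ) :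
    ∃ k K : ENNReal, k ≠ 0 ∧ K ≠ ⊤ ∧ ∀ x : Ed d, ‖x‖ ≤ r →
      k ≤ ENNReal.ofReal (Real.exp (-V x)) ∧ ENNReal.ofReal (Real.exp (-V x)) ≤ K := by
  obtain ⟨M, hM⟩ := hV r
  refine ⟨ENNReal.ofReal (Real.exp (-M)), ENNReal.ofReal (Real.exp M),
    by simp [Real.exp_pos], by simp, fun x hx => ⟨?_, ?_⟩⟩ <;>
  · gcongr
    linarith [hM x hx, neg_abs_le (V x), le_abs_self (V x)]

/-- The weight `infAnn` is controlled by the density inside a ball and by the inward mass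
outside of it. -/
lemma exists_infAnn_le {d : ℕ} {V : Ed d → ℝ} (hV : LocallyBounded d V) {R : ℝ} (hR : 1 ≤ R) :
    ∃ κ : ENNReal, κ ≠ ⊤ ∧ ∀ x, ENNReal.ofReal (infAnn d V x) ≤
      κ * (ENNReal.ofReal (Real.exp (-V x)) + (closedBall 0 R)ᶜ.indicator
        (inwardMass d fun y => ENNReal.ofReal (Real.exp (-V y))) x) := by
  obtain ⟨M, hM⟩ := hV R
  have hb0 := volume_closedBall_zero_pos d (r := 1/4) (by norm_num)
  have hbt := volume_closedBall_zero_ne_top d (1/4)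
  set b := volume (closedBall (0 : Ed d) (1/4))
  refine ⟨ENNReal.ofReal (Real.exp (2 * M)) + b⁻¹, ?_, fun x => ?_⟩
  · have := ENNReal.inv_ne_top.2 hb0
    finiteness
  by_cases hx : x ∈ closedBall (0 : Ed d) R
  · rw [mem_closedBall_zero_iff] at hx
    calc ENNReal.ofReal (infAnn d V x)
        ≤ ENNReal.ofReal (Real.exp (2 * M) * Real.exp (-V x)) := by
          refine ENNReal.ofReal_le_ofReal ((infAnn_le_exp hM hx).trans ?_)
          rw [← Real.exp_add, Real.exp_le_exp]
          linarith [hM x hx, le_abs_self (V x)]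
      _ = ENNReal.ofReal (Real.exp (2 * M)) * ENNReal.ofReal (Real.exp (-V x)) :=
          ENNReal.ofReal_mul (by positivity)
      _ ≤ _ := mul_le_mul' le_self_add le_self_add
  · rw [indicator_of_mem (show x ∈ (closedBall (0 : Ed d) R)ᶜ from hx)]
    have hx1 : 1 ≤ ‖x‖ := by
      rw [mem_closedBall_zero_iff] at hx
      linarith
    calc ENNReal.ofReal (infAnn d V x)
        = b⁻¹ * (ENNReal.ofReal (infAnn d V x) * b) := by
          rw [mul_comm, mul_assoc, ENNReal.mul_inv_cancel hb0 hbt, mul_one]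
      _ ≤ b⁻¹ * inwardMass d (fun y => ENNReal.ofReal (Real.exp (-V y))) x := by
          gcongr
          exact mul_volume_le_inwardMass d fun y hy =>
            ENNReal.ofReal_le_ofReal (infAnn_le_of_mem_inwardNbhd hx1 hy)
      _ ≤ _ := mul_le_mul' le_add_self le_add_self

lemma lintegral_muV {d : ℕ} {V : Ed d → ℝ} (hV : Measurable V) {h : Ed d → ENNReal}
    (hh : Measurable h) :
    ∫⁻ x, h x ∂muV d V = ENNReal.ofReal (∫ y, Real.exp (-V y))⁻¹ *
      ∫⁻ x, ENNReal.ofReal (Real.exp (-V x)) * h x := by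
  rw [muV, lintegral_withDensity_eq_lintegral_mul _ (by fun_prop) hh,
    ← lintegral_const_mul _ (by fun_prop)]
  refine lintegral_congr fun x => ?_
  rw [Pi.mul_apply, ENNReal.ofReal_mul (by positivity), mul_assoc]

lemma isProbabilityMeasure_muV {d : ℕ} {V : Ed d → ℝ} (hV : Measurable V)
    (hint : Integrable fun x => Real.exp (-V x)) : IsProbabilityMeasure (muV d V) := by
  have hW : 0 < ∫ y, Real.exp (-V y) := integral_exp_pos hint
  constructor
  rw [← lintegral_one, lintegral_muV hV measurable_const]
  simp_rw [mul_one]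
  rw [← ofReal_integral_eq_lintegral_ofReal hint (ae_of_all _ fun x => (Real.exp_pos _).le),
    ← ENNReal.ofReal_mul (by positivity), inv_mul_cancel₀ hW.ne', ENNReal.ofReal_one]

lemma CbSmooth.exists_bound {d : ℕ} {f : Ed d → ℝ} (hf : CbSmooth d f) :
    ∃ M, ∀ x, |f x| ≤ M := by
  obtain ⟨C, hC⟩ := hf.2 0
  exact ⟨C, fun x => by simpa using hC x⟩

lemma CbSmooth.exists_lipschitz {d : ℕ} {f : Ed d → ℝ} (hf : CbSmooth d f) :
    ∃ L, ∀ x y, |f x - f y| ≤ L * dist x y := by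
  obtain ⟨C, hC⟩ := hf.2 1
  refine ⟨C, fun x y => ?_⟩
  have := convex_univ.norm_image_sub_le_of_norm_fderiv_le (𝕜 := ℝ) (f := f) (C := C)
    (fun z _ => (hf.1.differentiable (by simp)).differentiableAt)
    (fun z _ => by
      have := hC z
      rwa [← zero_add 1, ← norm_iteratedFDeriv_fderiv, norm_iteratedFDeriv_zero] at this)
    (mem_univ y) (mem_univ x)
  rwa [Real.norm_eq_abs, ← dist_eq_norm] at this

lemma integrableOn_norm_rpow_closedBall {d : ℕ} (hd : 1 ≤ d) {s : ℝ} (hs : -(d : ℝ) < s)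
    (x : Ed d) :
    IntegrableOn (fun y => dist x y ^ s) (closedBall x 1) := by
  have : Nonempty (Fin d) := ⟨⟨0, hd⟩⟩
  have h0 : IntegrableOn (fun z : Ed d => ‖z‖ ^ s) (ball 0 2) := by
    rw [integrableOn_fun_norm_addHaar volume (f := fun t : ℝ => t ^ s), finrank_euclideanSpace_fin]
    refine ((intervalIntegral.integrableOn_Ioo_rpow_iff (s := d - 1 + s) two_pos).2
      (by linarith)).congr_fun (fun t ht => ?_) measurableSet_Ioo
    have ht0 : 0 < t := ht.1
    simp only [smul_eq_mul]
    rw [Real.rpow_add ht0, ← Nat.cast_one, ← Nat.cast_sub hd, Real.rpow_natCast]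
  have h1 := ((measurePreserving_sub_right volume x).integrableOn_comp_preimage
    (MeasurableEquiv.subRight x).measurableEmbedding).2 h0
  refine (h1.mono_set fun y hy => ?_).congr_fun (fun y _ => ?_) measurableSet_closedBall
  · rw [mem_preimage, mem_ball_zero_iff, ← dist_eq_norm]
    exact (mem_closedBall.1 hy).trans_lt one_lt_two
  · simp [dist_eq_norm, norm_sub_rev]

/-- The energy with flat kernel is controlled by the fractional Dirichlet form. -/
lemma flatEnergy_le_formE {d : ℕ} (hd : 1 ≤ d) {α : ℝ} (hα0 : 0 < α) (hα2 : α < 2)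
    {V : Ed d → ℝ} (hV : Measurable V) (hint : Integrable fun x => Real.exp (-V x))
    {f : Ed d → ℝ} (hf : CbSmooth d f) :
    ENNReal.ofReal (∫ y, Real.exp (-V y))⁻¹ *
      flatEnergy d (fun x => ENNReal.ofReal (Real.exp (-V x))) f ≤
        2 * ENNReal.ofReal (formE d α V f) := by
  have := isProbabilityMeasure_muV hV hint
  obtain ⟨L, hL⟩ := hf.exists_lipschitz
  have hfm : Measurable f := hf.1.continuous.measurable
  set F : Ed d → Ed d → ℝ := fun x y => (f x - f y) ^ 2 / dist x y ^ ((d : ℝ) + α) with hF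
  have hF0 : ∀ x y, 0 ≤ F x y := fun x y => by positivity
  have hFm : Measurable (Function.uncurry F) := by
    unfold Function.uncurry; fun_prop
  have hset : ∀ x : Ed d, {y | dist x y ≤ 1} = closedBall x 1 := fun x => by
    ext y; simp [dist_comm]
  have hFle : ∀ x y, F x y ≤ L ^ 2 * dist x y ^ (2 - ((d : ℝ) + α)) := by
    intro x y
    rcases eq_or_ne x y with rfl | hxy
    · simp only [hF, sub_self]
      norm_num
      positivity
    · have hxy' : 0 < dist x y := dist_pos.2 hxy
      rw [Real.rpow_sub hxy', Real.rpow_two, ← mul_div_assoc, ← mul_pow]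
      have : (f x - f y) ^ 2 ≤ (L * dist x y) ^ 2 :=
        sq_le_sq.2 ((hL x y).trans (le_abs_self _))
      simp only [hF]
      gcongr
  have hκ : ∀ x : Ed d, IntegrableOn
      (fun y => L ^ 2 * dist x y ^ (2 - ((d : ℝ) + α))) (closedBall x 1) := fun x =>
    (integrableOn_norm_rpow_closedBall hd (by linarith) x).const_mul _
  have hFint : ∀ x, IntegrableOn (F x) (closedBall x 1) := fun x =>
    (hκ x).mono' (hFm.comp measurable_prodMk_left).aestronglyMeasurable
      (ae_of_all _ fun y => by rw [Real.norm_of_nonneg (hF0 x y)]; exact hFle x y)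
  set Φ : Ed d → ℝ := fun x => ∫ y in closedBall x 1, F x y
  have hΦ0 : ∀ x, 0 ≤ Φ x := fun x => integral_nonneg (hF0 x)
  have hΦofReal : ∀ x, ENNReal.ofReal (Φ x) = ∫⁻ y in closedBall x 1, ENNReal.ofReal (F x y) :=
    fun x => ofReal_integral_eq_lintegral_ofReal (hFint x) (ae_of_all _ (hF0 x))
  have hΦm : Measurable Φ := by
    have : Φ = fun x => (∫⁻ y in closedBall x 1, ENNReal.ofReal (F x y)).toReal := by
      funext x
      rw [← hΦofReal, ENNReal.toReal_ofReal (hΦ0 x)]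
    rw [this]
    exact (measurable_setLIntegral_closedBall d (F := fun x y => ENNReal.ofReal (F x y))
      hFm.ennreal_ofReal).ennreal_toReal
  have hΦle : ∀ x, Φ x ≤ ∫ z in closedBall (0 : Ed d) 1, L ^ 2 * ‖z‖ ^ (2 - ((d : ℝ) + α)) := by
    intro x
    refine (setIntegral_mono (hFint x) (hκ x) (hFle x)).trans_eq ?_
    have hpre : (fun y => y - x) ⁻¹' closedBall (0 : Ed d) 1 = closedBall x 1 := by
      ext y; simp [dist_eq_norm]
    have := (measurePreserving_sub_right volume x).setIntegral_preimage_emb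
      (MeasurableEquiv.subRight x).measurableEmbedding
      (fun z => L ^ 2 * ‖z‖ ^ (2 - ((d : ℝ) + α))) (closedBall 0 1)
    rw [← this, hpre]
    simp_rw [dist_comm x, dist_eq_norm]
  have hΦint : Integrable Φ (muV d V) :=
    Integrable.of_bound hΦm.aestronglyMeasurable _
      (ae_of_all _ fun x => by rw [Real.norm_of_nonneg (hΦ0 x)]; exact hΦle x)
  have hform : 2 * ENNReal.ofReal (formE d α V f) = ∫⁻ x, ENNReal.ofReal (Φ x) ∂muV d V := by
    have h2 : 2 * formE d α V f = ∫ x, Φ x ∂muV d V := by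
      rw [formE]
      simp_rw [hset]
      rw [← mul_assoc]
      norm_num
      rfl
    rw [← ofReal_integral_eq_lintegral_ofReal hΦint (ae_of_all _ hΦ0), ← h2,
      ENNReal.ofReal_mul two_pos.le, ENNReal.ofReal_ofNat]
  rw [hform, lintegral_muV hV hΦm.ennreal_ofReal, flatEnergy]
  gcongr with x
  rw [hΦofReal, ← lintegral_const_mul _ (f := fun y => ENNReal.ofReal (F x y))
    (hFm.comp measurable_prodMk_left).ennreal_ofReal]
  refine setLIntegral_mono' measurableSet_closedBall fun y hy => ?_
  rw [mul_comm]
  gcongr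
  rcases eq_or_ne x y with rfl | hxy
  · simpa using hF0 x x
  · rw [mem_closedBall'] at hy
    exact le_div_self (sq_nonneg _) (Real.rpow_pos_of_pos (dist_pos.2 hxy) _)
      (Real.rpow_le_one dist_nonneg hy (by positivity))

lemma ofReal_sq_le_lintegral_sub_sq {Ω : Type*} [MeasurableSpace Ω] {μ : Measure Ω}
    [IsProbabilityMeasure μ] {f : Ω → ℝ} (hfm : Measurable f) {M : ℝ} (hM : ∀ x, |f x| ≤ M)
    (hf0 : ∫ x, f x ∂μ = 0) (m : ℝ) :
    ENNReal.ofReal (m ^ 2) ≤ ∫⁻ x, ENNReal.ofReal ((f x - m) ^ 2) ∂μ := by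
  have hfi : Integrable f μ := Integrable.of_bound hfm.aestronglyMeasurable M (ae_of_all _ hM)
  have hsq : Integrable (fun x => (f x - m) ^ 2) μ := by
    refine Integrable.of_bound (by fun_prop) ((M + |m|) ^ 2) (ae_of_all _ fun x => ?_)
    rw [Real.norm_of_nonneg (sq_nonneg _)]
    exact sq_le_sq.2 (((abs_sub _ _).trans (by gcongr; exact hM x)).trans (le_abs_self _))
  rw [← ofReal_integral_eq_lintegral_ofReal hsq (ae_of_all _ fun x => sq_nonneg _)]
  refine ENNReal.ofReal_le_ofReal ?_
  calc m ^ 2 = ∫ x, (m ^ 2 - 2 * m * f x) ∂μ := by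
        rw [integral_sub (integrable_const _) (hfi.const_mul _), integral_const_mul, hf0]
        simp
    _ ≤ _ := integral_mono ((integrable_const _).sub (hfi.const_mul _)) hsq fun x => by
        nlinarith [sq_nonneg (f x)]

/-- weighted Poincaré inequality for `𝓔_{α,V}` under the liminf condition. -/
theorem weighted_poincare_formE
    (d : ℕ) (hd : 1 ≤ d) (α : ℝ) (hα : 0 < α ∧ α < 2)
    (V : Ed d → ℝ) (hVmeas : Measurable V) (hVloc : LocallyBounded d V)
    (hVint : Integrable (fun x => Real.exp (-V x)))
    (hliminf : ∃ c : ℝ, thresholdConst d α < c ∧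
      ∃ R : ℝ, ∀ x : Ed d, R ≤ ‖x‖ → c ≤ infAnn d V x / supAnn d V x) :
    ∃ C₁ : ℝ, 0 < C₁ ∧ ∀ f : Ed d → ℝ, CbSmooth d f →
      (∫ x, f x ∂(muV d V)) = 0 →
      ∫ x, (f x) ^ 2 * (Real.exp (V x) * infAnn d V x) ∂(muV d V) ≤
        C₁ * formE d α V f := by
  obtain ⟨c, hc, R, hR⟩ := hliminf
  obtain ⟨n, hn⟩ := exists_nat_ge (2 * max R 1)
  have hn1 : 1 ≤ 1/2 + (n : ℝ)/2 := by linarith [le_max_right R 1]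
  have hnR : R ≤ 1/2 + (n : ℝ)/2 := by linarith [le_max_left R 1]
  set r : ℝ := 1/2 + (n : ℝ)/2
  set ψ : Ed d → ENNReal := fun x => ENNReal.ofReal (Real.exp (-V x))
  have hψ : Measurable ψ := by fun_prop
  have hψint : ∫⁻ x, ψ x ≠ ⊤ := hVint.lintegral_lt_top.ne
  obtain ⟨C, hC, hCf⟩ := exists_const_lintegral_sq_mul_le d hψ hψint hVloc.exists_bounds n
    fun x hx => by
      have hx' : r < ‖x‖ := by simpa only [mem_compl_iff, mem_closedBall_zero_iff, not_le] using hx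
      exact four_mul_volume_mul_le_inwardMass hVloc
        ((four_mul_pow_le_thresholdConst d hα.1).trans hc.le) (hn1.trans hx'.le)
        (hR x (hnR.trans hx'.le))
  obtain ⟨κ, hκ, hκI⟩ := exists_infAnn_le hVloc hn1
  set G : Ed d → ENNReal := fun x => ψ x + (closedBall 0 r)ᶜ.indicator (inwardMass d ψ) x
  have hGm : Measurable G :=
    hψ.add ((measurable_inwardMass d hψ).indicator measurableSet_closedBall.compl)
  have hGint : ∫⁻ x, G x ≠ ⊤ := by
    rw [lintegral_add_left hψ]
    refine ENNReal.add_ne_top.2 ⟨hψint, ne_top_of_le_ne_top (ENNReal.mul_ne_top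
      (volume_closedBall_zero_ne_top d 1) hψint) (le_trans ?_ (lintegral_inwardMass_le d hψ))⟩
    exact lintegral_mono fun x => indicator_le_self _ _ x
  set γ := ENNReal.ofReal (∫ y, Real.exp (-V y))⁻¹
  have := isProbabilityMeasure_muV hVmeas hVint
  set D : ENNReal := κ * (2 * C + 2 * C * (γ * ∫⁻ x, G x)) * 2
  have hD : D ≠ ⊤ := by finiteness
  refine ⟨D.toReal + 1, by positivity, fun f hf hf0 => ?_⟩
  have hfm : Measurable f := hf.1.continuous.measurable
  obtain ⟨M, hM⟩ := hf.exists_bound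
  obtain ⟨m, hm⟩ := hCf f hfm ⟨M, hM⟩
  have hE := flatEnergy_le_formE hd hα.1 hα.2 hVmeas hVint hf
  set 𝓔 := flatEnergy d ψ f
  have hm2 : ENNReal.ofReal (m ^ 2) ≤ γ * (C * 𝓔) := by
    refine (ofReal_sq_le_lintegral_sub_sq hfm hM hf0 m).trans ?_
    rw [lintegral_muV hVmeas (by fun_prop)]
    gcongr
    refine (lintegral_mono fun x => ?_).trans hm
    rw [mul_comm]
    gcongr
    exact le_self_add
  have hform0 : 0 ≤ formE d α V f := by
    refine mul_nonneg (by norm_num) (integral_nonneg fun x => integral_nonneg fun y => ?_)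
    positivity
  have hGf : ∫⁻ x, ENNReal.ofReal (f x ^ 2) * G x ≤
      2 * (C * 𝓔) + 2 * (γ * (C * 𝓔)) * ∫⁻ x, G x := by
    calc ∫⁻ x, ENNReal.ofReal (f x ^ 2) * G x
        ≤ ∫⁻ x, (2 * (ENNReal.ofReal ((f x - m) ^ 2) * G x) +
            2 * ENNReal.ofReal (m ^ 2) * G x) := by
          refine lintegral_mono fun x => ?_
          rw [← mul_assoc, ← add_mul]
          gcongr
          exact ofReal_sq_le_two_mul _ _
      _ = 2 * (∫⁻ x, ENNReal.ofReal ((f x - m) ^ 2) * G x) +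
            2 * ENNReal.ofReal (m ^ 2) * ∫⁻ x, G x := by
          rw [lintegral_add_right _ (by fun_prop), lintegral_const_mul _ (by fun_prop),
            lintegral_const_mul _ hGm]
      _ ≤ _ := by gcongr
  have hmain : ENNReal.ofReal (∫ x, (f x) ^ 2 * (Real.exp (V x) * infAnn d V x) ∂(muV d V)) ≤
      D * ENNReal.ofReal (formE d α V f) := by
    have hI0 : ∀ x, 0 ≤ infAnn d V x := fun x =>
      Real.sInf_nonneg (by rintro _ ⟨z, -, rfl⟩; positivity)
    calc ENNReal.ofReal (∫ x, (f x) ^ 2 * (Real.exp (V x) * infAnn d V x) ∂(muV d V))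
        ≤ ∫⁻ x, ‖(f x) ^ 2 * (Real.exp (V x) * infAnn d V x)‖ₑ ∂(muV d V) :=
          (Real.ofReal_le_enorm _).trans (enorm_integral_le_lintegral_enorm _)
      _ ≤ ∫⁻ x, ENNReal.ofReal (f x ^ 2) * (ENNReal.ofReal (Real.exp (V x)) * (κ * G x))
            ∂(muV d V) := by
          refine lintegral_mono fun x => ?_
          rw [Real.enorm_of_nonneg (mul_nonneg (sq_nonneg _)
            (mul_nonneg (Real.exp_pos _).le (hI0 x))), ENNReal.ofReal_mul (sq_nonneg _),
            ENNReal.ofReal_mul (Real.exp_pos _).le]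
          gcongr
          exact hκI x
      _ = γ * ∫⁻ x, κ * (ENNReal.ofReal (f x ^ 2) * G x) := by
          rw [lintegral_muV hVmeas (by fun_prop)]
          congr 1
          refine lintegral_congr fun x => ?_
          have : ENNReal.ofReal (Real.exp (-V x)) * ENNReal.ofReal (Real.exp (V x)) = 1 := by
            rw [← ENNReal.ofReal_mul (Real.exp_pos _).le, ← Real.exp_add]
            simp
          calc _ = ENNReal.ofReal (Real.exp (-V x)) * ENNReal.ofReal (Real.exp (V x)) *
                (κ * (ENNReal.ofReal (f x ^ 2) * G x)) := by ring
            _ = _ := by rw [this, one_mul]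
      _ ≤ γ * (κ * (2 * (C * 𝓔) + 2 * (γ * (C * 𝓔)) * ∫⁻ x, G x)) := by
          rw [lintegral_const_mul _ (by fun_prop)]
          gcongr
      _ = κ * (2 * C + 2 * C * (γ * ∫⁻ x, G x)) * (γ * 𝓔) := by ring
      _ ≤ κ * (2 * C + 2 * C * (γ * ∫⁻ x, G x)) * (2 * ENNReal.ofReal (formE d α V f)) := by
          gcongr
      _ = D * ENNReal.ofReal (formE d α V f) := by ring
  rw [← ENNReal.ofReal_toReal hD, ← ENNReal.ofReal_mul ENNReal.toReal_nonneg,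
    ENNReal.ofReal_le_ofReal_iff (by positivity)] at hmain
  linarith
end
end
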